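/- The series Σ_{j=0}^∞ a_j·a_{j+1}·ω_{j+1} converges and its sum is strictly greater than S₁ + √6·a₂₅²·ω₂₆. (Inequality (4.4) of Proposition 3.3: a lower bound for |⟨F, zF⟩_ω|.) -/

import Mathlib

open Finset

/-- The weights `ω_k = (2k choose k)/4^k`. -/
noncomputable def ω : ℕ → ℝ :=
  fun k => (Nat.choose (2 * k) k : ℝ) / 4 ^ k

/-- Maclaurin coefficients of `F(z) = (1 - √(2/3) z)^(-5/2)`. -/
noncomputable def a : ℕ → ℝ :=
  fun j => ∏ t ∈ Finset.Icc 1 j, (Real.sqrt (2 / 3) * (1 + 3 / (2 * (t : ℝ))))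

noncomputable def S₁ : ℝ :=
  Real.sqrt (2 / 3) * ∑ j ∈ Finset.range 25, (1 + 3 / (2 * ((j : ℝ) + 1))) * (a j) ^ 2 * ω (j + 1)

noncomputable def S₂ : ℝ :=
  ∑ j ∈ Finset.range 25, (a j) ^ 2 * ω (j + 1)

noncomputable def S₃ : ℝ :=
  (5 - Real.sqrt 6) * (a 25) ^ 2 * ω 26

noncomputable def S₄ : ℝ :=
  ∑ j ∈ Finset.range 25, (a j) ^ 2 * ω (j + 1) / ((j : ℝ) + 1)

lemma omega_pos (k : ℕ) : 0 < ω k := by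
  unfold ω
  have : 0 < Nat.choose (2 * k) k := Nat.choose_pos (by omega)
  positivity

lemma omega_succ (k : ℕ) : ω (k + 1) = ω k * ((2 * (k : ℝ) + 1) / (2 * k + 2)) := by
  have h := Nat.succ_mul_centralBinom_succ k
  unfold Nat.centralBinom at h
  have h' : ((k : ℝ) + 1) * (Nat.choose (2 * (k + 1)) (k + 1) : ℝ)
      = 2 * (2 * k + 1) * (Nat.choose (2 * k) k : ℝ) := by exact_mod_cast h
  have hk : (k : ℝ) + 1 ≠ 0 := by positivity
  have e : (Nat.choose (2 * (k + 1)) (k + 1) : ℝ)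
      = 2 * (2 * k + 1) * (Nat.choose (2 * k) k : ℝ) / (k + 1) := by
    rw [eq_div_iff hk]; linarith
  unfold ω
  rw [e, pow_succ]
  have h2 : 2 * (k : ℝ) + 2 = 2 * (k + 1) := by ring
  rw [h2]
  field_simp
  ring

lemma a_pos (j : ℕ) : 0 < a j := by
  unfold a
  refine Finset.prod_pos fun t _ => ?_
  have : 0 < Real.sqrt (2 / 3) := Real.sqrt_pos.2 (by norm_num)
  positivity

lemma a_succ (j : ℕ) :
    a (j + 1) = a j * (Real.sqrt (2 / 3) * (1 + 3 / (2 * ((j : ℝ) + 1)))) := by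
  unfold a
  rw [Finset.prod_Icc_succ_top (by omega)]
  push_cast
  rfl

lemma b_pos (j : ℕ) : 0 < a j ^ 2 * ω (j + 1) :=
  mul_pos (pow_pos (a_pos j) 2) (omega_pos _)

lemma term_eq (j : ℕ) : a j * a (j + 1) * ω (j + 1)
    = Real.sqrt (2 / 3) * ((1 + 3 / (2 * ((j : ℝ) + 1))) * a j ^ 2 * ω (j + 1)) := by
  rw [a_succ]; ring

lemma b_succ (j : ℕ) : a (j + 1) ^ 2 * ω (j + 1 + 1) = (a j ^ 2 * ω (j + 1)) *
    (2 / 3 * (1 + 3 / (2 * ((j : ℝ) + 1))) ^ 2 * ((2 * (j : ℝ) + 3) / (2 * j + 4))) := by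
  rw [a_succ, omega_succ (j + 1)]
  have hs : Real.sqrt (2 / 3) ^ 2 = 2 / 3 := Real.sq_sqrt (by norm_num)
  rw [mul_pow, mul_pow, hs]
  push_cast
  ring_nf

lemma b_ge (i : ℕ) : (a 25 ^ 2 * ω 26) * (2 / 3) ^ i ≤ a (i + 25) ^ 2 * ω (i + 25 + 1) := by
  induction i with
  | zero => simp
  | succ i ih =>
    have e : i + 1 + 25 = (i + 25) + 1 := by ring
    rw [e, b_succ (i + 25), pow_succ (2 / 3 : ℝ) i, ← mul_assoc (a 25 ^ 2 * ω 26)]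
    refine mul_le_mul ih ?_ (by norm_num) (b_pos _).le
    generalize i + 25 = j
    have : (1 : ℝ) ≤ (1 + 3 / (2 * ((j : ℝ) + 1))) ^ 2 * ((2 * (j : ℝ) + 3) / (2 * j + 4)) := by
      have hj : (0 : ℝ) ≤ j := Nat.cast_nonneg j
      have e2 : (1 + 3 / (2 * ((j : ℝ) + 1))) ^ 2 * ((2 * (j : ℝ) + 3) / (2 * j + 4))
        = ((2 * (j : ℝ) + 5) ^ 2 * (2 * j + 3)) / ((2 * (j + 1)) ^ 2 * (2 * j + 4)) := by
        field_simp
        ring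
      rw [e2, le_div_iff₀ (by positivity)]
      nlinarith [mul_nonneg hj hj]
    linarith

lemma term_pos (j : ℕ) : 0 < a j * a (j + 1) * ω (j + 1) :=
  mul_pos (mul_pos (a_pos _) (a_pos _)) (omega_pos _)

lemma term_summable : Summable (fun j : ℕ => a j * a (j + 1) * ω (j + 1)) := by
  refine summable_of_ratio_norm_eventually_le (r := 5 / 6) (by norm_num) ?_
  filter_upwards [Filter.eventually_ge_atTop 24] with j hj
  rw [Real.norm_of_nonneg (term_pos _).le, Real.norm_of_nonneg (term_pos _).le]
  rw [term_eq, term_eq, mul_assoc _ (a (j + 1) ^ 2), b_succ]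
  have hs : 0 < Real.sqrt (2 / 3) := Real.sqrt_pos.2 (by norm_num)
  have hb := b_pos j
  have hj' : (24 : ℝ) ≤ j := by exact_mod_cast hj
  set u : ℝ := 1 + 3 / (2 * ((j : ℝ) + 1)) with hu
  have hu1 : 1 ≤ u := by
    have : 0 ≤ 3 / (2 * ((j : ℝ) + 1)) := by positivity
    linarith
  have hu2 : u ≤ 1.06 := by
    have : 3 / (2 * ((j : ℝ) + 1)) ≤ 0.06 := by
      rw [div_le_iff₀ (by positivity)]; linarith
    linarith
  have hv : 1 + 3 / (2 * (((j + 1 : ℕ) : ℝ) + 1)) ≤ 1.06 := by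
    have : 3 / (2 * (((j + 1 : ℕ) : ℝ) + 1)) ≤ 0.06 := by
      push_cast
      rw [div_le_iff₀ (by positivity)]; linarith
    linarith
  have hw : (2 * (j : ℝ) + 3) / (2 * j + 4) ≤ 1 := by
    rw [div_le_iff₀ (by positivity)]; linarith
  have hw0 : 0 ≤ (2 * (j : ℝ) + 3) / (2 * j + 4) := by positivity
  have hv0 : 0 ≤ 1 + 3 / (2 * (((j + 1 : ℕ) : ℝ) + 1)) := by positivity
  generalize 1 + 3 / (2 * (((j + 1 : ℕ) : ℝ) + 1)) = v at *
  generalize (2 * (j : ℝ) + 3) / (2 * j + 4) = w at *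
  generalize Real.sqrt (2 / 3) = s at *
  have key : v * (2 / 3 * u * w) ≤ 5 / 6 := by
    have h1 : v * u ≤ 1.06 * 1.06 := mul_le_mul hv hu2 (by linarith) (by norm_num)
    have h2 : v * u * w ≤ (1.06 * 1.06) * 1 := mul_le_mul h1 hw hw0 (by norm_num)
    linarith
  have hp : 0 ≤ s * (u * (a j ^ 2 * ω (j + 1))) := by positivity
  have := mul_le_mul_of_nonneg_left key hp
  linarith

theorem inner_product_lower_bound :
    Summable (fun j : ℕ => a j * a (j + 1) * ω (j + 1)) ∧
    (∑' j : ℕ, a j * a (j + 1) * ω (j + 1)) > S₁ + Real.sqrt 6 * (a 25) ^ 2 * ω 26 := by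
  refine ⟨term_summable, ?_⟩
  rw [← term_summable.sum_add_tsum_nat_add 25]
  have h1 : ∑ j ∈ Finset.range 25, a j * a (j + 1) * ω (j + 1) = S₁ := by
    unfold S₁
    rw [Finset.mul_sum]
    exact Finset.sum_congr rfl fun j _ => term_eq j
  rw [h1]
  have hs : 0 < Real.sqrt (2 / 3) := Real.sqrt_pos.2 (by norm_num)
  have h6 : Real.sqrt 6 = Real.sqrt (2 / 3) * 3 := by
    rw [show (6 : ℝ) = 2 / 3 * 3 ^ 2 by norm_num, Real.sqrt_mul (by norm_num),
      Real.sqrt_sq (by norm_num)]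
  have hg := hasSum_geometric_of_lt_one (r := (2 / 3 : ℝ)) (by norm_num) (by norm_num)
  have hg2 := hg.mul_left (Real.sqrt (2 / 3) * (a 25 ^ 2 * ω 26))
  have hlt : ∀ i : ℕ, Real.sqrt (2 / 3) * (a 25 ^ 2 * ω 26) * (2 / 3) ^ i
      < a (i + 25) * a (i + 25 + 1) * ω (i + 25 + 1) := by
    intro i
    rw [term_eq, mul_assoc]
    refine mul_lt_mul_of_pos_left ((b_ge i).trans_lt ?_) hs
    have hb := b_pos (i + 25)
    rw [mul_assoc]
    refine lt_mul_of_one_lt_left hb ?_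
    have : 0 < 3 / (2 * (((i + 25 : ℕ) : ℝ) + 1)) := by positivity
    linarith
  have hsum := (summable_nat_add_iff 25).2 term_summable
  have := hg2.summable.tsum_lt_tsum (i := 0) (fun i => (hlt i).le) (hlt 0) hsum
  rw [hg2.tsum_eq] at this
  rw [h6]
  norm_num at this ⊢
  linarith
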